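/- arXiv:1408.6872 — 3 statements merged into one kernel-verified Lean document; each statement's English description precedes it below -/
import Mathlib

section
/- The function G : (0,∞) → ℝ defined by G(x) = (1 − e^{−x})² / (x − 1 + e^{−x}) is strictly decreasing (strictly antitone) on (0,∞), and G(x) tends to 2 as x tends to 0 from the right. In particular G(x) ≤ 2 for all x > 0. -/
open Filter

theorem hasDerivAt_one_sub_exp_neg (x : ℝ) :
    HasDerivAt (fun x : ℝ => 1 - Real.exp (-x)) (Real.exp (-x)) x := by
  simpa using ((hasDerivAt_neg x).exp).const_sub 1

theorem hasDerivAt_one_sub_exp_neg_sq (x : ℝ) :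
    HasDerivAt (fun x : ℝ => (1 - Real.exp (-x)) ^ 2)
      (2 * (1 - Real.exp (-x)) * Real.exp (-x)) x := by
  simpa using (hasDerivAt_one_sub_exp_neg x).fun_pow 2

theorem hasDerivAt_sub_one_add_exp_neg (x : ℝ) :
    HasDerivAt (fun x : ℝ => x - 1 + Real.exp (-x)) (1 - Real.exp (-x)) x := by
  simpa [sub_eq_add_neg] using ((hasDerivAt_id x).sub_const 1).fun_add (hasDerivAt_neg x).exp

theorem sub_one_add_exp_neg_pos {x : ℝ} (hx : 0 < x) : 0 < x - 1 + Real.exp (-x) := by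
  linarith [Real.add_one_lt_exp (neg_ne_zero.mpr hx.ne')]

theorem one_sub_exp_neg_pos {x : ℝ} (hx : 0 < x) : 0 < 1 - Real.exp (-x) :=
  sub_pos.mpr (by simpa using hx)

/-- After expansion this is the inequality `x < sinh x`. -/
theorem two_mul_exp_neg_mul_lt_sq {x : ℝ} (hx : 0 < x) :
    2 * Real.exp (-x) * (x - 1 + Real.exp (-x)) < (1 - Real.exp (-x)) ^ 2 := by
  have h := Real.self_lt_sinh_iff.mpr hx
  rw [Real.sinh_eq] at h
  have hmul : Real.exp x * Real.exp (-x) = 1 := by simp [← Real.exp_add]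
  nlinarith [mul_lt_mul_of_pos_right h (Real.exp_pos (-x))]

theorem strictAntiOn_one_sub_exp_neg_sq_div :
    StrictAntiOn (fun x : ℝ => (1 - Real.exp (-x)) ^ 2 / (x - 1 + Real.exp (-x)))
      (Set.Ioi 0) := by
  have hderiv : ∀ x : ℝ, 0 < x → HasDerivAt _ _ x := fun x hx =>
    (hasDerivAt_one_sub_exp_neg_sq x).fun_div (hasDerivAt_sub_one_add_exp_neg x)
      (sub_one_add_exp_neg_pos hx).ne'
  refine strictAntiOn_of_deriv_neg (convex_Ioi 0)
    (fun x hx => (hderiv x hx).continuousAt.continuousWithinAt) fun x hx => ?_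
  rw [interior_Ioi] at hx
  rw [(hderiv x hx).deriv]
  refine div_neg_of_neg_of_pos ?_ (pow_pos (sub_one_add_exp_neg_pos hx) 2)
  nlinarith [mul_lt_mul_of_pos_left (two_mul_exp_neg_mul_lt_sq hx) (one_sub_exp_neg_pos hx)]

theorem tendsto_one_sub_exp_neg_sq_div :
    Tendsto (fun x : ℝ => (1 - Real.exp (-x)) ^ 2 / (x - 1 + Real.exp (-x)))
      (nhdsWithin 0 (Set.Ioi 0)) (nhds 2) := by
  refine HasDerivAt.lhopital_zero_nhdsGT
    (Eventually.of_forall hasDerivAt_one_sub_exp_neg_sq)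
    (Eventually.of_forall hasDerivAt_sub_one_add_exp_neg) ?_ ?_ ?_ ?_
  · filter_upwards [self_mem_nhdsWithin] with x hx using (one_sub_exp_neg_pos hx).ne'
  · simpa using (hasDerivAt_one_sub_exp_neg_sq 0).continuousAt.tendsto.mono_left
      nhdsWithin_le_nhds
  · simpa using (hasDerivAt_sub_one_add_exp_neg 0).continuousAt.tendsto.mono_left
      nhdsWithin_le_nhds
  · have hlim : Tendsto (fun x : ℝ => 2 * Real.exp (-x)) (nhdsWithin 0 (Set.Ioi 0))
        (nhds 2) := by
      have hcont : Continuous fun x : ℝ => 2 * Real.exp (-x) := by fun_prop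
      simpa using (hcont.tendsto 0).mono_left nhdsWithin_le_nhds
    refine hlim.congr' ?_
    filter_upwards [self_mem_nhdsWithin] with x hx
    have := (one_sub_exp_neg_pos hx).ne'
    field_simp

/-- The function `G(x) = (1 − e^{−x})²/(x − 1 + e^{−x})` is strictly decreasing on
`(0,∞)`, tends to `2` as `x → 0⁺`, and in particular `G(x) ≤ 2` for all `x > 0`. -/
theorem strictAntiOn_one_sub_exp_sq_div :
    StrictAntiOn (fun x : ℝ => (1 - Real.exp (-x)) ^ 2 / (x - 1 + Real.exp (-x)))
      (Set.Ioi 0) ∧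
    Tendsto (fun x : ℝ => (1 - Real.exp (-x)) ^ 2 / (x - 1 + Real.exp (-x)))
      (nhdsWithin 0 (Set.Ioi 0)) (nhds 2) ∧
    ∀ x : ℝ, 0 < x →
      (1 - Real.exp (-x)) ^ 2 / (x - 1 + Real.exp (-x)) ≤ 2 := by
  refine ⟨strictAntiOn_one_sub_exp_neg_sq_div, tendsto_one_sub_exp_neg_sq_div,
    fun x hx => ge_of_tendsto tendsto_one_sub_exp_neg_sq_div ?_⟩
  filter_upwards [Ioo_mem_nhdsGT hx] with y hy
  exact (strictAntiOn_one_sub_exp_neg_sq_div hy.1 hx hy.2).le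
end

section
/- Let ρ > 0, ρ₂₀ > 0, T > 0 and 0 < t < T. Set x := ρ(T−t), a := (1 − e^{−x})/ρ and I := (e^{−x} − 1 + x)/ρ². Then I > 0 and −e^{−x} + ρ·a − a²/(ρ₂₀·I) + 1 + 2/ρ₂₀ ≥ 0. -/
/-- The second-order bound `(1 - e^{-x})² ≤ 2 (e^{-x} - 1 + x)` for nonnegative `x`. -/
theorem Real.sq_one_sub_exp_neg_le {x : ℝ} (hx : 0 ≤ x) :
    (1 - Real.exp (-x)) ^ 2 ≤ 2 * (Real.exp (-x) - 1 + x) := by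
  have hderiv (y : ℝ) : HasDerivAt
      (fun z : ℝ => 2 * (Real.exp (-z) - 1 + z) - (1 - Real.exp (-z)) ^ 2)
      (2 * (1 - Real.exp (-y)) ^ 2) y := by
    have hexp : HasDerivAt (fun z : ℝ => Real.exp (-z)) (-Real.exp (-y)) y := by
      simpa using (hasDerivAt_neg y).exp
    refine ((((hexp.sub_const 1).add (hasDerivAt_id y)).const_mul 2).sub
      ((hexp.const_sub 1).pow 2)).congr_deriv ?_
    push_cast
    ring
  have hmono := monotone_of_deriv_nonneg (fun y => (hderiv y).differentiableAt)
    fun y => (hderiv y).deriv ▸ by positivity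
  have h := hmono hx
  norm_num at h
  linarith

/-- Verification of the first differential inequality in the proof of the gradient
bound (part (c)): with `x = ρ(T−t)`, `a = (1 − e^{−x})/ρ` and
`I = (e^{−x} − 1 + x)/ρ²`, one has `I > 0` and
`−e^{−x} + ρ a − a²/(ρ₂₀ I) + 1 + 2/ρ₂₀ ≥ 0`. -/
theorem gradient_bound_first_ineq (ρ ρ₂₀ T t : ℝ)
    (hρ : 0 < ρ) (hρ₂₀ : 0 < ρ₂₀) (hT : 0 < T) (ht : 0 < t) (htT : t < T)
    (x a I : ℝ)
    (hx : x = ρ * (T - t))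
    (ha : a = (1 - Real.exp (-x)) / ρ)
    (hI : I = (Real.exp (-x) - 1 + x) / ρ ^ 2) :
    0 < I ∧
      0 ≤ -Real.exp (-x) + ρ * a - a ^ 2 / (ρ₂₀ * I) + 1 + 2 / ρ₂₀ := by
  have hxpos : 0 < x := hx ▸ mul_pos hρ (sub_pos.mpr htT)
  have hnum : 0 < Real.exp (-x) - 1 + x := by
    linarith [Real.add_one_lt_exp (neg_ne_zero.mpr hxpos.ne')]
  have hIpos : 0 < I := hI ▸ by positivity
  refine ⟨hIpos, ?_⟩
  have hρa : ρ * a = 1 - Real.exp (-x) := by rw [ha]; field_simp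
  have haI : a ^ 2 ≤ 2 * I := by
    rw [ha, hI, div_pow, ← mul_div_assoc]
    gcongr
    exact Real.sq_one_sub_exp_neg_le hxpos.le
  have hquot : a ^ 2 / (ρ₂₀ * I) ≤ 2 / ρ₂₀ := by
    rw [div_le_div_iff₀ (by positivity) hρ₂₀]
    nlinarith
  have hexp : Real.exp (-x) < 1 := by simpa using hxpos
  linarith
end

section
/- Let E be a nontrivial finite-dimensional real inner product space and let u : ℝ × E → ℝ be a smooth function with u(t,x) > 0 for all (t,x), satisfying the backward heat equation ∂_t u(t,x) + (1/2)·Δ(u(t,·))(x) = 0 for all (t,x), where Δ denotes the Laplacian on E. Then for all (t,x): ∂_t (log u)(t,x) + (1/2)·Δ(log u(t,·))(x) = −‖∇(u(t,·))(x)‖² / (2·u(t,x)²), where ∇ denotes the gradient on E. -/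
open Real

/-- The Laplacian of `f : E → ℝ` on a finite-dimensional real inner product space:
the trace of the second derivative over an orthonormal basis. -/
noncomputable def laplacian {E : Type*} [NormedAddCommGroup E] [InnerProductSpace ℝ E]
    [FiniteDimensional ℝ E] (f : E → ℝ) (x : E) : ℝ :=
  ∑ i, iteratedFDeriv ℝ 2 f x ![stdOrthonormalBasis ℝ E i, stdOrthonormalBasis ℝ E i]

/-- The second derivative of `log f` along `v`. -/
theorem iteratedFDeriv_two_log {E : Type*} [NormedAddCommGroup E] [NormedSpace ℝ E]
    {f : E → ℝ} (hf : ContDiff ℝ 2 f) (hpos : ∀ y, 0 < f y) (x v : E) :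
    iteratedFDeriv ℝ 2 (fun y => Real.log (f y)) x ![v, v]
      = (f x)⁻¹ * iteratedFDeriv ℝ 2 f x ![v, v] - (fderiv ℝ f x v) ^ 2 / f x ^ 2 := by
  have hd : Differentiable ℝ f := hf.differentiable (by norm_num)
  have hlog : fderiv ℝ (fun y => Real.log (f y)) = fun y => (f y)⁻¹ • fderiv ℝ f y :=
    funext fun y => fderiv.log (hd y) (hpos y).ne'
  have hinv : HasFDerivAt (fun y => (f y)⁻¹) (-(f x ^ 2)⁻¹ • fderiv ℝ f x) x :=
    (hasDerivAt_inv (hpos x).ne').comp_hasFDerivAt x (hd x).hasFDerivAt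
  have hdd : DifferentiableAt ℝ (fderiv ℝ f) x :=
    (hf.fderiv_right (m := 1) (by norm_num)).differentiable (by norm_num) x
  rw [iteratedFDeriv_two_apply, iteratedFDeriv_two_apply, hlog,
    (hinv.fun_smul hdd.hasFDerivAt).fderiv]
  simp
  ring

/-- The chain rule `Δ (log f) = Δ f / f - ‖∇ f‖² / f²`. -/
theorem laplacian_log {E : Type*} [NormedAddCommGroup E] [InnerProductSpace ℝ E]
    [FiniteDimensional ℝ E] {f : E → ℝ} (hf : ContDiff ℝ 2 f) (hpos : ∀ y, 0 < f y) (x : E) :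
    laplacian (fun y => Real.log (f y)) x
      = (f x)⁻¹ * laplacian f x - ‖gradient f x‖ ^ 2 / f x ^ 2 := by
  have hgrad : ‖gradient f x‖ ^ 2 = ∑ i, (fderiv ℝ f x (stdOrthonormalBasis ℝ E i)) ^ 2 := by
    rw [← (stdOrthonormalBasis ℝ E).sum_sq_norm_inner_left]
    simp [inner_gradient_left]
  simp only [laplacian, iteratedFDeriv_two_log hf hpos, Finset.sum_sub_distrib, hgrad,
    Finset.mul_sum, Finset.sum_div]

/-- If `u > 0` is smooth and satisfies the backward heat equation
`∂ₜ u + (1/2) Δ u = 0`, then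
`∂ₜ (log u) + (1/2) Δ (log u) = −‖∇u‖²/(2u²)`. -/
theorem backward_heat_log {E : Type*} [NormedAddCommGroup E] [InnerProductSpace ℝ E]
    [FiniteDimensional ℝ E] [Nontrivial E]
    (u : ℝ × E → ℝ) (hu : ContDiff ℝ (⊤ : ℕ∞) u) (hpos : ∀ p, 0 < u p)
    (hheat : ∀ (t : ℝ) (x : E),
      deriv (fun s => u (s, x)) t + (1 / 2) * laplacian (fun y => u (t, y)) x = 0) :
    ∀ (t : ℝ) (x : E),
      deriv (fun s => Real.log (u (s, x))) t
          + (1 / 2) * laplacian (fun y => Real.log (u (t, y))) x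
        = -‖gradient (fun y => u (t, y)) x‖ ^ 2 / (2 * u (t, x) ^ 2) := by
  intro t x
  have hspace : ContDiff ℝ 2 (fun y => u (t, y)) :=
    (contDiff_infty.1 hu 2).comp (contDiff_const.prodMk contDiff_id)
  have htime : DifferentiableAt ℝ (fun s => u (s, x)) t :=
    ((hu.differentiable (by simp)).comp
      (differentiable_id.prodMk (differentiable_const x))) t
  have hne : u (t, x) ≠ 0 := (hpos (t, x)).ne'
  rw [laplacian_log hspace (fun y => hpos (t, y)), deriv.log htime hne,
    eq_neg_of_add_eq_zero_left (hheat t x)]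
  field_simp
  ring
end
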